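/- arXiv:math/0611293 — 4 statements merged into one kernel-verified Lean document; each statement's English description precedes it below -/
import Mathlib

section
/- Let a, a', b be integers, each at least 10. Then a' ≥ a if and only if a' _ b ≥ a _ b. -/
/-- The dungeon operation: interpret the base-10 digits of `a` in base `b`. -/
def dungeon (a b : ℕ) : ℕ := Nat.ofDigits b (Nat.digits 10 a)

theorem dungeon_eq_mod_add (a b : ℕ) : dungeon a b = a % 10 + b * dungeon (a / 10) b := by
  rcases Nat.eq_zero_or_pos a with rfl | h
  · simp [dungeon]
  · rw [dungeon, Nat.digits_def' (by norm_num) h, Nat.ofDigits_cons]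
    rfl

theorem dungeon_strictMono_left {b : ℕ} (hb : 10 ≤ b) : StrictMono fun a => dungeon a b := by
  intro a a' h
  induction a' using Nat.strong_induction_on generalizing a with
  | _ a' ih =>
    simp only at ih ⊢
    rw [dungeon_eq_mod_add a, dungeon_eq_mod_add a']
    rcases (Nat.div_le_div_right h.le : a / 10 ≤ a' / 10).lt_or_eq with hlt | heq
    · have hmul := Nat.mul_le_mul_left b (Nat.succ_le_of_lt (ih (a' / 10) (by omega) hlt))
      rw [Nat.mul_succ] at hmul
      omega
    · rw [heq]
      omega

theorem dungeon_le_left_iff (a a' b : ℕ) (ha : 10 ≤ a) (ha' : 10 ≤ a') (hb : 10 ≤ b) :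
    a ≤ a' ↔ dungeon a b ≤ dungeon a' b := by
  exact (dungeon_strictMono_left hb).le_iff_le.symm
end

section
/- Let γ be the sequence of natural numbers defined for n ≥ 10 by γ(10) = 10 and γ(n+1) = (n+1) _ γ(n). Then log log γ(n) is asymptotic to n · log log n as n → ∞; that is, the ratio (log log γ(n)) / (n · log log n) tends to 1, where log denotes the logarithm to base 10. -/
open Real Filter

theorem pow_log_le_dungeon {a b : ℕ} (ha : a ≠ 0) (hb : 2 ≤ b) :
    b ^ Nat.log 10 a ≤ dungeon a b := by
  obtain ⟨c, rfl⟩ := Nat.exists_eq_add_of_le' hb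
  have hne : Nat.digits 10 a ≠ [] := Nat.digits_ne_nil_iff_ne_zero.2 ha
  have h := Nat.pow_length_le_mul_ofDigits (b := c) hne (Nat.getLast_digit_ne_zero 10 ha)
  rw [Nat.length_digits 10 a (by norm_num) ha, pow_succ'] at h
  exact Nat.le_of_mul_le_mul_left h (by omega)

theorem dungeon_le_pow_log_succ {a b : ℕ} (ha : a ≠ 0) (hb : 10 ≤ b) :
    dungeon a b ≤ b ^ (Nat.log 10 a + 1) := by
  rw [← Nat.length_digits 10 a (by norm_num) ha]
  exact (Nat.ofDigits_lt_base_pow_length (by omega) fun x hx =>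
    (Nat.digits_lt_base (by norm_num) hx).trans_le hb).le

theorem one_le_logb_ten {x : ℝ} (hx : 10 ≤ x) : 1 ≤ logb 10 x := by
  rw [le_logb_iff_rpow_le (by norm_num) (by linarith)]
  simpa using hx

theorem logb_ten_sub_le {x y : ℝ} (hx : 0 < x) (hxy : x ≤ y) :
    logb 10 y - logb 10 x ≤ (y - x) / x := by
  have h10 : 1 ≤ log 10 := by
    rw [le_log_iff_exp_le (by norm_num)]
    linarith [exp_one_lt_d9]
  have hy : 0 < y := hx.trans_le hxy
  have hlog : log (y / x) ≤ (y - x) / x := by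
    have h := log_le_sub_one_of_pos (div_pos hy hx)
    rwa [sub_div, div_self hx.ne']
  rw [← logb_div hy.ne' hx.ne', logb]
  exact (div_le_self (log_nonneg ((one_le_div hx).2 hxy)) h10).trans hlog

/-- Prefixing a dungeon operation by `m` raises the iterated logarithm by `log log m + O(1)`. -/
theorem abs_logb_logb_dungeon_sub_le {m b : ℕ} (hm : 10 ≤ m) (hb : 10 ≤ b) :
    |logb 10 (logb 10 (dungeon m b)) - logb 10 (logb 10 b) - logb 10 (logb 10 m)| ≤ 1 := by
  have hm0 : m ≠ 0 := by omega
  set d := Nat.log 10 m with hd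
  have hd1 : 1 ≤ d := Nat.log_pos (by norm_num) hm
  have hd1' : (1 : ℝ) ≤ d := by exact_mod_cast hd1
  have hb' : (10 : ℝ) ≤ b := by exact_mod_cast hb
  have hm' : (10 : ℝ) ≤ m := by exact_mod_cast hm
  have hlb : 1 ≤ logb 10 (b : ℝ) := one_le_logb_ten hb'
  have hlow : (b : ℝ) ^ d ≤ dungeon m b := by
    exact_mod_cast pow_log_le_dungeon hm0 (by omega : 2 ≤ b)
  have hupp : (dungeon m b : ℝ) ≤ (b : ℝ) ^ (d + 1) := by
    exact_mod_cast dungeon_le_pow_log_succ hm0 hb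
  have hpow : (0 : ℝ) < (b : ℝ) ^ d := by positivity
  have h1 : d * logb 10 (b : ℝ) ≤ logb 10 (dungeon m b : ℝ) := by
    rw [← logb_pow]
    exact logb_le_logb_of_le (by norm_num) hpow hlow
  have h2 : logb 10 (dungeon m b : ℝ) ≤ (d + 1) * logb 10 (b : ℝ) := by
    have h := logb_le_logb_of_le (b := 10) (by norm_num) (hpow.trans_le hlow) hupp
    rwa [logb_pow, Nat.cast_add_one] at h
  have h3 : (d : ℝ) ≤ logb 10 (m : ℝ) := by
    rw [le_logb_iff_rpow_le (by norm_num) (by linarith), rpow_natCast]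
    exact_mod_cast Nat.pow_log_le_self 10 hm0
  have h4 : logb 10 (m : ℝ) ≤ d + 1 := by
    rw [logb_le_iff_le_rpow (by norm_num) (by linarith), ← Nat.cast_add_one, rpow_natCast]
    exact_mod_cast (Nat.lt_pow_succ_log_self (by norm_num) m).le
  have hdb : 0 < d * logb 10 (b : ℝ) := by positivity
  have k1 := logb_le_logb_of_le (b := 10) (by norm_num) hdb h1
  have k2 := logb_le_logb_of_le (b := 10) (by norm_num) (hdb.trans_le h1) h2
  have k3 := logb_le_logb_of_le (b := 10) (by norm_num) (by linarith) h3
  have k4 := logb_le_logb_of_le (b := 10) (by norm_num) (by linarith) h4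
  rw [logb_mul (by positivity) (by positivity)] at k1 k2
  have k5 := logb_ten_sub_le (x := (d : ℝ)) (y := d + 1) (by linarith) (by linarith)
  have k6 : ((d : ℝ) + 1 - d) / d ≤ 1 := by
    rw [div_le_one (by linarith)]
    linarith
  rw [abs_le]
  constructor <;> linarith

theorem mul_logb_logb_succ_sub_mem_Icc {x : ℝ} (hx : 10 ≤ x) :
    x * (logb 10 (logb 10 (x + 1)) - logb 10 (logb 10 x)) ∈ Set.Icc 0 1 := by
  have hl : 1 ≤ logb 10 x := one_le_logb_ten hx
  have hle : logb 10 x ≤ logb 10 (x + 1) :=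
    logb_le_logb_of_le (by norm_num) (by linarith) (by linarith)
  have hle2 : logb 10 (logb 10 x) ≤ logb 10 (logb 10 (x + 1)) :=
    logb_le_logb_of_le (by norm_num) (by linarith) hle
  refine ⟨mul_nonneg (by linarith) (by linarith), ?_⟩
  have h1 := logb_ten_sub_le (x := x) (y := x + 1) (by linarith) (by linarith)
  have h2 := logb_ten_sub_le (by linarith) hle
  have h3 := h2.trans (div_le_self (by linarith) hl)
  have h4 := mul_le_mul_of_nonneg_left (h3.trans h1) (by linarith : 0 ≤ x)
  rwa [add_sub_cancel_left, mul_one_div_cancel (by linarith)] at h4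

theorem ten_le_of_dungeon_rec {γ : ℕ → ℕ} (hγ0 : γ 10 = 10)
    (hγ : ∀ n, 10 ≤ n → γ (n + 1) = dungeon (n + 1) (γ n)) {n : ℕ} (hn : 10 ≤ n) :
    10 ≤ γ n := by
  induction n, hn using Nat.le_induction with
  | base => exact hγ0.ge
  | succ n hn ih =>
    rw [hγ n hn]
    have hd : 1 ≤ Nat.log 10 (n + 1) := Nat.log_pos (by norm_num) (by omega)
    calc 10 ≤ γ n := ih
      _ ≤ γ n ^ Nat.log 10 (n + 1) := Nat.le_self_pow (by omega) _
      _ ≤ _ := pow_log_le_dungeon (by omega) (by omega)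

theorem abs_logb_logb_sub_le_of_dungeon_rec {γ : ℕ → ℕ} (hγ0 : γ 10 = 10)
    (hγ : ∀ n, 10 ≤ n → γ (n + 1) = dungeon (n + 1) (γ n)) {n : ℕ} (hn : 10 ≤ n) :
    |logb 10 (logb 10 (γ n)) - n * logb 10 (logb 10 n)| ≤ 2 * n := by
  induction n, hn using Nat.le_induction with
  | base => simp [hγ0]
  | succ n hn ih =>
    have h1 := abs_logb_logb_dungeon_sub_le (m := n + 1) (by omega)
      (ten_le_of_dungeon_rec hγ0 hγ hn)
    obtain ⟨h2, h3⟩ := mul_logb_logb_succ_sub_mem_Icc (x := n) (by exact_mod_cast hn)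
    rw [hγ n hn]
    push_cast at h1 ⊢
    rw [abs_le] at *
    constructor <;> linarith

theorem gamma_loglog_asymptotic (γ : ℕ → ℕ) (hγ0 : γ 10 = 10)
    (hγ : ∀ n, 10 ≤ n → γ (n + 1) = dungeon (n + 1) (γ n)) :
    Tendsto (fun n : ℕ =>
        logb 10 (logb 10 (γ n)) / (n * logb 10 (logb 10 n))) atTop (nhds 1) := by
  have hlog : Tendsto (logb 10) atTop atTop := tendsto_logb_atTop (by norm_num)
  have hll : Tendsto (fun n : ℕ => logb 10 (logb 10 (n : ℝ))) atTop atTop :=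
    hlog.comp (hlog.comp tendsto_natCast_atTop_atTop)
  have h0 : Tendsto (fun n : ℕ => 2 / logb 10 (logb 10 (n : ℝ))) atTop (nhds 0) :=
    hll.const_div_atTop 2
  rw [tendsto_iff_norm_sub_tendsto_zero]
  refine squeeze_zero' (Eventually.of_forall fun _ => norm_nonneg _) ?_ h0
  filter_upwards [hll.eventually_gt_atTop 0, eventually_ge_atTop 10] with n hpos hn
  have hn0 : (0 : ℝ) < n := by exact_mod_cast (by omega : 0 < n)
  have hmul : 0 < n * logb 10 (logb 10 (n : ℝ)) := mul_pos hn0 hpos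
  rw [div_sub_one hmul.ne', norm_eq_abs, abs_div, abs_of_pos hmul, div_le_div_iff₀ hmul hpos]
  calc _ ≤ 2 * n * logb 10 (logb 10 (n : ℝ)) :=
        mul_le_mul_of_nonneg_right (abs_logb_logb_sub_le_of_dungeon_rec hγ0 hγ hn) hpos.le
    _ = _ := by ring
end

section
/- For n ≥ 10 let δ(n) = ((⋯((n _ (n−1)) _ (n−2)) ⋯) _ 10) be the bottom-up-parenthesized descending dungeon; formally, δ(n) = e(n, 10) where e(n, n) = n and e(n, m) = e(n, m+1) _ m for 10 ≤ m < n. Then log log δ(n) is asymptotic to n · log log n as n → ∞; that is, the ratio (log log δ(n)) / (n · log log n) tends to 1, where log denotes the logarithm to base 10. -/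
open Real Filter

theorem le_dungeon {a b : ℕ} (hb : 10 ≤ b) : a ≤ dungeon a b := by
  have h := Nat.ofDigits_monotone (Nat.digits 10 a) hb
  rwa [Nat.ofDigits_digits] at h

theorem logb_dungeon_le {a b : ℕ} (ha : a ≠ 0) (hb : 10 ≤ b) :
    logb 10 (dungeon a b) ≤ (logb 10 a + 1) * logb 10 b := by
  have hb0 : 0 ≤ logb 10 (b : ℝ) := logb_nonneg (by norm_num) (by norm_cast; omega)
  have ha' : (0 : ℝ) < a := by exact_mod_cast Nat.pos_of_ne_zero ha
  have hd : (0 : ℝ) < dungeon a b := by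
    exact_mod_cast (Nat.pos_of_ne_zero ha).trans_le (le_dungeon hb)
  have hlt : dungeon a b < b ^ (Nat.digits 10 a).length :=
    Nat.ofDigits_lt_base_pow_length (by omega)
      fun x hx => (Nat.digits_lt_base (by norm_num) hx).trans_le hb
  have hlen : 10 ^ (Nat.digits 10 a).length ≤ 10 * a := by
    have h := Nat.pow_length_le_mul_ofDigits (b := 8) (Nat.digits_ne_nil_iff_ne_zero.mpr ha)
      (Nat.getLast_digit_ne_zero 10 ha)
    simpa [Nat.ofDigits_digits] using h
  have h1 : ((Nat.digits 10 a).length : ℝ) ≤ logb 10 a + 1 := by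
    have h : ((10 : ℝ) ^ (Nat.digits 10 a).length) ≤ 10 * a := by exact_mod_cast hlen
    have h := logb_le_logb_of_le (b := 10) (by norm_num) (by positivity) h
    rw [logb_pow, logb_mul (by norm_num) ha'.ne', logb_self_eq_one (by norm_num)] at h
    linarith
  have h2 : logb 10 (dungeon a b) ≤ (Nat.digits 10 a).length * logb 10 b := by
    rw [← logb_pow]
    exact logb_le_logb_of_le (by norm_num) hd (by exact_mod_cast hlt.le)
  exact h2.trans (by gcongr)

theorem le_logb_dungeon {a b : ℕ} (ha : a ≠ 0) (hb : 10 ≤ b) :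
    (logb 10 a - 1) * logb 10 b ≤ logb 10 (dungeon a b) := by
  have hb0 : 0 ≤ logb 10 (b : ℝ) := logb_nonneg (by norm_num) (by norm_cast; omega)
  have hb' : (0 : ℝ) < b := by norm_cast; omega
  have ha' : (0 : ℝ) < a := by exact_mod_cast Nat.pos_of_ne_zero ha
  have hd : (0 : ℝ) < dungeon a b := by
    exact_mod_cast (Nat.pos_of_ne_zero ha).trans_le (le_dungeon hb)
  have h1 : logb 10 a ≤ (Nat.digits 10 a).length := by
    have h : a < 10 ^ (Nat.digits 10 a).length := Nat.lt_base_pow_length_digits (by norm_num)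
    have h : (a : ℝ) ≤ 10 ^ (Nat.digits 10 a).length := by exact_mod_cast h.le
    have h := logb_le_logb_of_le (b := 10) (by norm_num) ha' h
    rwa [logb_pow, logb_self_eq_one (by norm_num), mul_one] at h
  have h2 : ((Nat.digits 10 a).length : ℝ) * logb 10 b ≤ logb 10 b + logb 10 (dungeon a b) := by
    obtain ⟨c, rfl⟩ : ∃ c, b = c + 2 := ⟨b - 2, by omega⟩
    have h := Nat.pow_length_le_mul_ofDigits (b := c) (Nat.digits_ne_nil_iff_ne_zero.mpr ha)
      (Nat.getLast_digit_ne_zero 10 ha)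
    rw [← logb_pow, ← logb_mul hb'.ne' hd.ne']
    exact logb_le_logb_of_le (by norm_num) (by positivity) (by exact_mod_cast h)
  nlinarith [mul_le_mul_of_nonneg_right h1 hb0]

section Descending

variable {e : ℕ → ℕ → ℕ} {n : ℕ}

theorem descending_antitone (hstep : ∀ m, 10 ≤ m → m < n → e n m = dungeon (e n (m + 1)) m)
    {m l : ℕ} (hm : 10 ≤ m) (hml : m ≤ l) (hl : l ≤ n) : e n l ≤ e n m := by
  induction l, hml using Nat.le_induction with
  | base => exact le_rfl
  | succ l hml ih =>
    refine le_trans ?_ (ih (by omega))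
    rw [hstep l (by omega) (by omega)]
    exact le_dungeon (by omega)

theorem le_descending (hdiag : e n n = n)
    (hstep : ∀ m, 10 ≤ m → m < n → e n m = dungeon (e n (m + 1)) m)
    {m : ℕ} (hm : 10 ≤ m) (hmn : m ≤ n) : n ≤ e n m := by
  have h := descending_antitone hstep hm hmn le_rfl
  rwa [hdiag] at h

theorem logb_le_logb_descending (hdiag : e n n = n)
    (hstep : ∀ m, 10 ≤ m → m < n → e n m = dungeon (e n (m + 1)) m)
    {m : ℕ} (hm : 10 ≤ m) (hmn : m ≤ n) : logb 10 n ≤ logb 10 (e n m) :=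
  logb_le_logb_of_le (by norm_num) (by norm_cast; omega)
    (by exact_mod_cast le_descending hdiag hstep hm hmn)

theorem logb_descending_le (hdiag : e n n = n)
    (hstep : ∀ m, 10 ≤ m → m < n → e n m = dungeon (e n (m + 1)) m)
    (hn : 1 ≤ logb 10 (n : ℝ)) (k : ℕ) :
    ∀ m, 10 ≤ m → m + k = n → logb 10 (e n m) ≤ logb 10 n * (2 * logb 10 n) ^ k := by
  induction k with
  | zero => rintro m - rfl; simp [show e m m = m from hdiag]
  | succ k ih =>
    intro m hm hmk
    have ih := ih (m + 1) (by omega) (by omega)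
    have hge := logb_le_logb_descending hdiag hstep (m := m + 1) (by omega) (by omega)
    have hne : e n (m + 1) ≠ 0 := by
      have := le_descending hdiag hstep (m := m + 1) (by omega) (by omega)
      omega
    have hlog : logb 10 (m : ℝ) ≤ logb 10 n :=
      logb_le_logb_of_le (by norm_num) (by norm_cast; omega) (by norm_cast; omega)
    have hlog0 : 0 ≤ logb 10 (m : ℝ) := logb_nonneg (by norm_num) (by norm_cast; omega)
    rw [hstep m hm (by omega)]
    calc logb 10 (dungeon (e n (m + 1)) m)
        ≤ (logb 10 (e n (m + 1)) + 1) * logb 10 m := logb_dungeon_le hne hm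
      _ ≤ (2 * logb 10 (e n (m + 1))) * logb 10 n := by gcongr <;> linarith
      _ ≤ (2 * (logb 10 n * (2 * logb 10 n) ^ k)) * logb 10 n := by gcongr
      _ = _ := by ring

theorem le_logb_descending (hdiag : e n n = n)
    (hstep : ∀ m, 10 ≤ m → m < n → e n m = dungeon (e n (m + 1)) m)
    (hn : 2 ≤ logb 10 (n : ℝ)) {M : ℕ} (hM : n ≤ M * M) (hM10 : 10 ≤ M) (k : ℕ) :
    ∀ m, M ≤ m → m + k = n → logb 10 n * (logb 10 n / 4) ^ k ≤ logb 10 (e n m) := by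
  induction k with
  | zero => rintro m - rfl; simp [show e m m = m from hdiag]
  | succ k ih =>
    intro m hm hmk
    have ih := ih (m + 1) (by omega) (by omega)
    have hge := logb_le_logb_descending hdiag hstep (m := m + 1) (by omega) (by omega)
    have hne : e n (m + 1) ≠ 0 := by
      have := le_descending hdiag hstep (m := m + 1) (by omega) (by omega)
      omega
    have hlog : logb 10 (n : ℝ) / 2 ≤ logb 10 m := by
      have hnm : (n : ℝ) ≤ (m : ℝ) ^ 2 := by
        have : n ≤ m ^ 2 := by nlinarith
        exact_mod_cast this
      have h := logb_le_logb_of_le (b := 10) (by norm_num) (by norm_cast; omega) hnm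
      rw [logb_pow] at h
      push_cast at h
      linarith
    rw [hstep m (by omega) (by omega)]
    calc logb 10 n * (logb 10 n / 4) ^ (k + 1)
        = (logb 10 n * (logb 10 n / 4) ^ k) / 2 * (logb 10 n / 2) := by ring
      _ ≤ logb 10 (e n (m + 1)) / 2 * (logb 10 n / 2) := by gcongr
      _ ≤ (logb 10 (e n (m + 1)) - 1) * logb 10 m := by
        gcongr <;> linarith
      _ ≤ _ := le_logb_dungeon hne (by omega)

theorem logb_logb_descending_le (hdiag : e n n = n)
    (hstep : ∀ m, 10 ≤ m → m < n → e n m = dungeon (e n (m + 1)) m)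
    (hn : 100 ≤ n) (hlog : 2 ≤ logb 10 (n : ℝ)) :
    logb 10 (logb 10 (e n 10)) ≤ n * (logb 10 2 + logb 10 (logb 10 n)) := by
  have hge := logb_le_logb_descending hdiag hstep le_rfl (by omega)
  have h := logb_descending_le hdiag hstep (by linarith) (n - 10) 10 le_rfl (by omega)
  rw [← logb_mul (by norm_num) (by positivity), ← logb_pow]
  refine logb_le_logb_of_le (by norm_num) (by linarith) (h.trans ?_)
  calc logb 10 (n : ℝ) * (2 * logb 10 n) ^ (n - 10)
      ≤ (2 * logb 10 n) * (2 * logb 10 n) ^ (n - 10) := by gcongr; linarith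
    _ = (2 * logb 10 n) ^ (n - 10 + 1) := by ring
    _ ≤ _ := pow_le_pow_right₀ (by linarith) (by omega)

theorem le_logb_logb_descending (hdiag : e n n = n)
    (hstep : ∀ m, 10 ≤ m → m < n → e n m = dungeon (e n (m + 1)) m)
    (hn : 100 ≤ n) (hlog : 4 ≤ logb 10 (n : ℝ)) :
    (n - (√n + 1)) * (logb 10 (logb 10 n) - logb 10 4) ≤ logb 10 (logb 10 (e n 10)) := by
  have h10 : 10 ≤ Nat.sqrt n := Nat.le_sqrt.2 (by omega)
  have hsq : Nat.sqrt n + 1 ≤ n := by have := Nat.sqrt_lt_self (n := n) (by omega); omega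
  have h := le_logb_descending hdiag hstep (by linarith) (M := Nat.sqrt n + 1)
    (Nat.sqrt_lt.1 (Nat.lt_succ_self _)).le (by omega) (n - (Nat.sqrt n + 1))
    (Nat.sqrt n + 1) le_rfl (by omega)
  have hanti : logb 10 (e n (Nat.sqrt n + 1)) ≤ logb 10 (e n 10) := by
    refine logb_le_logb_of_le (by norm_num) ?_ ?_
    · have := le_descending hdiag hstep (m := Nat.sqrt n + 1) (by omega) hsq
      norm_cast; omega
    · exact_mod_cast descending_antitone hstep le_rfl (by omega) hsq
  have hq : 0 ≤ logb 10 (logb 10 (n : ℝ) / 4) := logb_nonneg (by norm_num) (by linarith)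
  rw [← logb_div (by positivity) (by norm_num)]
  calc ((n : ℝ) - (√n + 1)) * logb 10 (logb 10 n / 4)
      ≤ ((n - (Nat.sqrt n + 1) : ℕ) : ℝ) * logb 10 (logb 10 n / 4) := by
        gcongr
        rw [Nat.cast_sub hsq]
        push_cast
        linarith [Real.nat_sqrt_le_real_sqrt (a := n)]
    _ ≤ _ := by
      rw [← logb_pow]
      refine logb_le_logb_of_le (by norm_num) (by positivity) (le_trans ?_ (h.trans hanti))
      exact le_mul_of_one_le_left (by positivity) (by linarith)

end Descending

theorem delta_loglog_asymptotic (e : ℕ → ℕ → ℕ) (δ : ℕ → ℕ)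
    (hdiag : ∀ n, e n n = n)
    (hstep : ∀ n m, 10 ≤ m → m < n → e n m = dungeon (e n (m + 1)) m)
    (hδ : ∀ n, 10 ≤ n → δ n = e n 10) :
    Tendsto (fun n : ℕ =>
        logb 10 (logb 10 (δ n)) / (n * logb 10 (logb 10 n))) atTop (nhds 1) := by
  have hcast : Tendsto (fun n : ℕ => (n : ℝ)) atTop atTop := tendsto_natCast_atTop_atTop
  have hlog : Tendsto (fun n : ℕ => logb 10 (n : ℝ)) atTop atTop :=
    (tendsto_logb_atTop (by norm_num)).comp hcast
  have hloglog : Tendsto (fun n : ℕ => logb 10 (logb 10 (n : ℝ))) atTop atTop :=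
    (tendsto_logb_atTop (by norm_num)).comp hlog
  have hsqrt : Tendsto (fun n : ℕ => √(n : ℝ)) atTop atTop := tendsto_sqrt_atTop.comp hcast
  have hlower : Tendsto (fun n : ℕ => (1 - (1 / √(n : ℝ) + 1 / (n : ℝ))) *
      (1 - logb 10 4 / logb 10 (logb 10 (n : ℝ)))) atTop (nhds 1) := by
    have h := (((hsqrt.const_div_atTop 1).add (hcast.const_div_atTop 1)).const_sub 1).mul
      ((hloglog.const_div_atTop (logb 10 4)).const_sub 1)
    simpa using h
  have hupper : Tendsto (fun n : ℕ => logb 10 2 / logb 10 (logb 10 (n : ℝ)) + 1)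
      atTop (nhds 1) := by
    simpa using (hloglog.const_div_atTop (logb 10 2)).add_const 1
  refine tendsto_of_tendsto_of_tendsto_of_le_of_le' hlower hupper ?_ ?_
  · filter_upwards [eventually_ge_atTop 100, hlog.eventually_ge_atTop 4,
      hloglog.eventually_gt_atTop 0] with n hn hl hll
    have hn0 : (0 : ℝ) < n := by norm_cast; omega
    rw [hδ n (by omega), le_div_iff₀ (by positivity)]
    refine le_of_eq_of_le ?_ (le_logb_logb_descending (hdiag n) (hstep n) hn hl)
    have hs : √(n : ℝ) ≠ 0 := by positivity
    have hns : (n : ℝ) / √n = √n := Real.div_sqrt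
    calc _ = (n - (n / √(n : ℝ) + 1)) * (logb 10 (logb 10 (n : ℝ)) - logb 10 4) := by
          field_simp
      _ = _ := by rw [hns]
  · filter_upwards [eventually_ge_atTop 100, hlog.eventually_ge_atTop 2,
      hloglog.eventually_gt_atTop 0] with n hn hl hll
    have hn0 : (0 : ℝ) < n := by norm_cast; omega
    rw [hδ n (by omega), div_le_iff₀ (by positivity)]
    refine (logb_logb_descending_le (hdiag n) (hstep n) hn hl).trans_eq ?_
    field_simp
end

section
/- For all n ≥ 10, β(n) ≥ α(n), where α(n) = f(10, n) with f(n, n) = n and f(k, n) = k _ f(k+1, n) for 10 ≤ k < n, and β(10) = 10, β(n+1) = β(n) _ (n+1). -/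
theorem dungeon_zero (c : ℕ) : dungeon 0 c = 0 := by simp [dungeon]

theorem dungeon_eq_mod_add_mul_div (m c : ℕ) :
    dungeon m c = m % 10 + c * dungeon (m / 10) c := by
  rcases Nat.eq_zero_or_pos m with rfl | hm
  · simp [dungeon]
  · unfold dungeon
    rw [Nat.digits_def' (by norm_num) hm, Nat.ofDigits_cons]

theorem dungeon_ten_mul_add (q d c : ℕ) (hd : d < 10) :
    dungeon (10 * q + d) c = d + c * dungeon q c := by
  rw [dungeon_eq_mod_add_mul_div, show (10 * q + d) % 10 = d by lia,
    show (10 * q + d) / 10 = q by lia]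

theorem dungeon_of_lt_ten {d : ℕ} (c : ℕ) (hd : d < 10) : dungeon d c = d := by
  simpa [dungeon_zero] using dungeon_ten_mul_add 0 d c hd

theorem dungeon_ten_mul (m c : ℕ) : dungeon (10 * m) c = c * dungeon m c := by
  simpa using dungeon_ten_mul_add m 0 c (by norm_num)

theorem self_le_dungeon (m : ℕ) {c : ℕ} (hc : 10 ≤ c) : m ≤ dungeon m c := by
  induction m using Nat.strong_induction_on with
  | _ m ih =>
    rcases Nat.eq_zero_or_pos m with rfl | hm
    · exact Nat.zero_le _
    · rw [dungeon_eq_mod_add_mul_div]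
      have := Nat.mul_le_mul hc (ih (m / 10) (by lia))
      lia

theorem dungeon_add_one_le (m : ℕ) {c : ℕ} (hc : 10 ≤ c) :
    dungeon m c + 1 ≤ dungeon (m + 1) c := by
  induction m using Nat.strong_induction_on with
  | _ m ih =>
    rw [dungeon_eq_mod_add_mul_div m, dungeon_eq_mod_add_mul_div (m + 1)]
    by_cases h : m % 10 = 9
    · have h1 := ih (m / 10) (by lia)
      rw [show (m + 1) / 10 = m / 10 + 1 by lia]
      have := Nat.mul_le_mul_left c h1
      rw [mul_add] at this
      lia
    · rw [show (m + 1) / 10 = m / 10 by lia]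
      lia

theorem dungeon_add_le (x y : ℕ) {c : ℕ} (hc : 10 ≤ c) :
    dungeon x c + dungeon y c ≤ dungeon (x + y) c := by
  induction x using Nat.strong_induction_on generalizing y with
  | _ x ih =>
    rcases Nat.eq_zero_or_pos x with rfl | hx
    · simp [dungeon_zero]
    · have h := Nat.mul_le_mul_left c (ih (x / 10) (by lia) (y / 10))
      rw [mul_add] at h
      rw [dungeon_eq_mod_add_mul_div x, dungeon_eq_mod_add_mul_div y,
        dungeon_eq_mod_add_mul_div (x + y)]
      by_cases hcarry : x % 10 + y % 10 < 10
      · rw [show (x + y) / 10 = x / 10 + y / 10 by lia]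
        lia
      · have h1 := Nat.mul_le_mul_left c (dungeon_add_one_le (x / 10 + y / 10) hc)
        rw [mul_add] at h1
        rw [show (x + y) / 10 = x / 10 + y / 10 + 1 by lia]
        lia

theorem mul_dungeon_le (d y : ℕ) {c : ℕ} (hc : 10 ≤ c) :
    d * dungeon y c ≤ dungeon (d * y) c := by
  induction d with
  | zero => simp
  | succ d ih =>
    rw [add_mul, add_mul, one_mul, one_mul]
    exact (Nat.add_le_add_right ih _).trans (dungeon_add_le _ _ hc)

theorem dungeon_mul_le (x y : ℕ) {c : ℕ} (hc : 10 ≤ c) :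
    dungeon x c * dungeon y c ≤ dungeon (x * y) c := by
  induction x using Nat.strong_induction_on with
  | _ x ih =>
    rcases Nat.eq_zero_or_pos x with rfl | hx
    · simp [dungeon_zero]
    · calc dungeon x c * dungeon y c
          = x % 10 * dungeon y c + c * (dungeon (x / 10) c * dungeon y c) := by
            rw [dungeon_eq_mod_add_mul_div x]; ring
        _ ≤ dungeon (x % 10 * y) c + c * dungeon (x / 10 * y) c :=
            Nat.add_le_add (mul_dungeon_le _ _ hc) (Nat.mul_le_mul_left c (ih _ (by lia)))
        _ ≤ dungeon (x % 10 * y + 10 * (x / 10 * y)) c := by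
            rw [← dungeon_ten_mul]; exact dungeon_add_le _ _ hc
        _ = dungeon (x * y) c := by
            rw [← mul_assoc, ← add_mul, Nat.mod_add_div]

theorem dungeon_dungeon_le (a b : ℕ) {c : ℕ} (hc : 10 ≤ c) :
    dungeon a (dungeon b c) ≤ dungeon (dungeon a b) c := by
  induction a using Nat.strong_induction_on with
  | _ a ih =>
    rcases Nat.eq_zero_or_pos a with rfl | ha
    · simp [dungeon_zero]
    · calc dungeon a (dungeon b c)
          = dungeon (a % 10) c + dungeon b c * dungeon (a / 10) (dungeon b c) := by
            rw [dungeon_eq_mod_add_mul_div a, dungeon_of_lt_ten c (Nat.mod_lt a (by norm_num : 10 > 0))]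
        _ ≤ dungeon (a % 10) c + dungeon (b * dungeon (a / 10) b) c :=
            Nat.add_le_add_left ((Nat.mul_le_mul_left _ (ih _ (by lia))).trans
              (dungeon_mul_le _ _ hc)) _
        _ ≤ dungeon (dungeon a b) c := by
            rw [dungeon_eq_mod_add_mul_div a b]; exact dungeon_add_le _ _ hc

theorem beta_ge_alpha (f : ℕ → ℕ → ℕ) (α β : ℕ → ℕ)
    (hdiag : ∀ n, f n n = n)
    (hstep : ∀ k n, 10 ≤ k → k < n → f k n = dungeon k (f (k + 1) n))
    (hα : ∀ n, 10 ≤ n → α n = f 10 n)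
    (hβ0 : β 10 = 10)
    (hβ : ∀ n, 10 ≤ n → β (n + 1) = dungeon (β n) (n + 1)) :
    ∀ n, 10 ≤ n → α n ≤ β n := by
  intro n hn
  have hf : ∀ k, k ≤ n → 10 ≤ k → k ≤ f k n := by
    intro k hk
    induction hk using Nat.decreasingInduction with
    | self => exact fun _ => (hdiag n).ge
    | of_succ k hk ih =>
      intro h
      rw [hstep k n h hk]
      exact self_le_dungeon k (by have := ih (by lia); lia)
  have hchain : ∀ k, k ≤ n → 10 ≤ k → k < n → dungeon (β k) (f (k + 1) n) ≤ β n := by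
    intro k hk
    induction hk using Nat.decreasingInduction with
    | self => exact fun _ h => absurd h (lt_irrefl n)
    | of_succ k hk ih =>
      intro h _
      rcases Nat.eq_or_lt_of_le (Nat.succ_le_of_lt hk) with rfl | hlt
      · rw [hdiag, hβ k h]
      · have hlarge := hf (k + 2) hlt (by lia)
        rw [hstep (k + 1) n (by lia) hlt]
        refine (dungeon_dungeon_le (β k) (k + 1) (by lia)).trans ?_
        rw [← hβ k h]
        exact ih (by lia) hlt
  rw [hα n hn]
  rcases Nat.eq_or_lt_of_le hn with rfl | hlt
  · rw [hdiag, hβ0]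
  · rw [hstep 10 n le_rfl hlt]
    simpa only [hβ0] using hchain 10 hn le_rfl hlt
end
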